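/- Let C ∈ (ℝ²)*⊗(ℝ²)*⊗ℝ² satisfy ρ_{s,C} = λ·Id for some λ ≠ 0 (definite symmetric Ricci tensor in normal form), and assume C ≠ C₊. Then for any point P ∈ ℝ⁺×ℝ, any smooth vector field X defined on a connected open neighborhood of P in ℝ⁺×ℝ which satisfies the affine Killing equation for ∇^C is of the form X = α(x¹∂_{x¹} + x²∂_{x²}) + β∂_{x²} for constants α, β ∈ ℝ. (The Lie algebra of germs of affine Killing vector fields is exactly the 2-dimensional algebra 𝔥.) -/

import Mathlib

open scoped BigOperators
open Matrix

/-- The Ricci matrix `ρ_C` of the Type B connection with Christoffel symbols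
`Γ_{ij}{}^k = C_{ij}{}^k/x¹` (evaluated at `x¹ = 1`; indices are 0-based, so
`C 0 0 0 = C₁₁¹`, etc.). -/
noncomputable def rhoC (C : Fin 2 → Fin 2 → Fin 2 → ℝ) : Matrix (Fin 2) (Fin 2) ℝ :=
  !![(C 0 0 0 - C 0 1 1 + 1) * C 1 0 1 + C 0 0 1 * (C 1 1 1 - C 1 0 0),
     C 1 1 1 + C 0 1 0 * C 1 0 1 - C 0 0 1 * C 1 1 0;
     -C 1 0 0 + C 0 1 0 * C 1 0 1 - C 0 0 1 * C 1 1 0,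
     (C 0 0 0 - C 0 1 1 - 1) * C 1 1 0 + C 0 1 0 * (C 1 1 1 - C 1 0 0)]

/-- The symmetric Ricci matrix `ρ_{s,C} = (ρ_C + ρ_Cᵀ)/2`. -/
noncomputable def rhoS (C : Fin 2 → Fin 2 → Fin 2 → ℝ) : Matrix (Fin 2) (Fin 2) ℝ :=
  (1 / 2 : ℝ) • (rhoC C + (rhoC C)ᵀ)
/-- The partial derivative `∂_{x^i} f` of a function on `ℝ²`. -/
noncomputable def pd (i : Fin 2) (f : ℝ × ℝ → ℝ) : ℝ × ℝ → ℝ :=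
  fun p => fderiv ℝ f p (if i = 0 then (1, 0) else (0, 1))

/-- The Christoffel symbols `Γ_{ij}{}^k = C_{ij}{}^k/x¹` of the Type B connection `∇^C`. -/
noncomputable def Gam (C : Fin 2 → Fin 2 → Fin 2 → ℝ) (i j k : Fin 2) : ℝ × ℝ → ℝ :=
  fun p => C i j k / p.1

/-- The affine Killing equation for a vector field `X = X¹∂₁ + X²∂₂` (components
`fun p => X p l`) with respect to the Type B connection `∇^C`, at the point `p`:
`∂_i∂_j X^l + Σ_k (X^k ∂_k Γ_{ij}{}^l + Γ_{kj}{}^l ∂_i X^k + Γ_{ik}{}^l ∂_j X^k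
  − Γ_{ij}{}^k ∂_k X^l) = 0` for all `i j l`. -/
noncomputable def IsAffineKillingAt (C : Fin 2 → Fin 2 → Fin 2 → ℝ)
    (X : ℝ × ℝ → Fin 2 → ℝ) (p : ℝ × ℝ) : Prop :=
  ∀ i j l : Fin 2,
    pd i (pd j fun q => X q l) p
      + ∑ k : Fin 2,
          (X p k * pd k (Gam C i j l) p
            + Gam C k j l p * pd i (fun q => X q k) p
            + Gam C i k l p * pd j (fun q => X q k) p
            - Gam C i j k p * pd k (fun q => X q l) p) = 0

/-- The Christoffel constants `C₊` of the hyperbolic metric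
`g₊ = ((dx¹)² + (dx²)²)/(x¹)²`: `C₁₁¹ = C₁₂² = C₂₁² = −1`, `C₂₂¹ = 1`,
all other components `0` (0-based indices). -/
noncomputable def Cplus : Fin 2 → Fin 2 → Fin 2 → ℝ :=
  ![![![-1, 0], ![0, -1]], ![![0, -1], ![1, 0]]]

theorem pd_congr {U : Set (ℝ × ℝ)} (hU : IsOpen U) {f g : ℝ × ℝ → ℝ}
    (hfg : ∀ q ∈ U, f q = g q) {p : ℝ × ℝ} (hp : p ∈ U) (m : Fin 2) : pd m f p = pd m g p := by
  have h : f =ᶠ[nhds p] g := Filter.eventuallyEq_of_mem (hU.mem_nhds hp) hfg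
  simp only [pd, h.fderiv_eq]

theorem ContDiffAt.pd {f : ℝ × ℝ → ℝ} {p : ℝ × ℝ} (hf : ContDiffAt ℝ (⊤ : ℕ∞) f p)
    (i : Fin 2) : ContDiffAt ℝ (⊤ : ℕ∞) (pd i f) p :=
  (hf.fderiv_right (m := ((⊤ : ℕ∞) : WithTop ℕ∞)) (by simp)).clm_apply contDiffAt_const

theorem pd_comm {f : ℝ × ℝ → ℝ} {p : ℝ × ℝ} (hf : ContDiffAt ℝ (⊤ : ℕ∞) f p) (i j : Fin 2) :
    pd i (pd j f) p = pd j (pd i f) p := by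
  have hd : DifferentiableAt ℝ (fderiv ℝ f) p :=
    (hf.fderiv_right (m := ((⊤ : ℕ∞) : WithTop ℕ∞)) (by simp)).differentiableAt (by simp)
  have key (v w : ℝ × ℝ) :
      fderiv ℝ (fun q => fderiv ℝ f q v) p w = fderiv ℝ (fderiv ℝ f) p w v := by
    rw [fderiv_clm_apply hd (differentiableAt_const v)]
    simp
  have hs : IsSymmSndFDerivAt ℝ f p :=
    hf.isSymmSndFDerivAt (by
      simp only [minSmoothness_of_isRCLikeNormedField]
      exact WithTop.coe_le_coe.2 (le_top : (2 : ℕ∞) ≤ ⊤))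
  unfold pd
  rw [key, key]
  exact hs _ _

theorem pd_fst_mul {f : ℝ × ℝ → ℝ} {p : ℝ × ℝ} (hf : DifferentiableAt ℝ f p) (m : Fin 2) :
    pd m (fun q => q.1 * f q) p = (if m = 0 then 1 else 0) * f p + p.1 * pd m f p := by
  unfold pd
  rw [fderiv_fun_mul differentiableAt_fst hf, fderiv_fst]
  fin_cases m <;> simp [add_comm]

theorem pd_const_mul {f : ℝ × ℝ → ℝ} {p : ℝ × ℝ} (hf : DifferentiableAt ℝ f p) (c : ℝ)
    (m : Fin 2) : pd m (fun q => c * f q) p = c * pd m f p := by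
  unfold pd
  rw [fderiv_const_mul hf]
  simp

theorem pd_neg (f : ℝ × ℝ → ℝ) (p : ℝ × ℝ) (m : Fin 2) :
    pd m (fun q => -f q) p = -pd m f p := by
  simp [pd, fderiv_fun_neg]

theorem pd_add {f g : ℝ × ℝ → ℝ} {p : ℝ × ℝ} (hf : DifferentiableAt ℝ f p)
    (hg : DifferentiableAt ℝ g p) (m : Fin 2) :
    pd m (fun q => f q + g q) p = pd m f p + pd m g p := by
  simp [pd, fderiv_fun_add hf hg]

theorem pd_sub {f g : ℝ × ℝ → ℝ} {p : ℝ × ℝ} (hf : DifferentiableAt ℝ f p)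
    (hg : DifferentiableAt ℝ g p) (m : Fin 2) :
    pd m (fun q => f q - g q) p = pd m f p - pd m g p := by
  simp [pd, fderiv_fun_sub hf hg]

theorem fderiv_eq_zero_of_pd {f : ℝ × ℝ → ℝ} {p : ℝ × ℝ} (h : ∀ i, pd i f p = 0) :
    fderiv ℝ f p = 0 := by
  have h0 := h 0
  have h1 := h 1
  simp only [pd] at h0 h1
  ext <;> simp_all

theorem pd_Gam (C : Fin 2 → Fin 2 → Fin 2 → ℝ) (i j l k : Fin 2) {p : ℝ × ℝ} (hp : p.1 ≠ 0) :
    pd k (Gam C i j l) p = (if k = 0 then 1 else 0) * (-C i j l / p.1 ^ 2) := by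
  have h : HasFDerivAt (Gam C i j l)
      ((-C i j l / p.1 ^ 2) • ContinuousLinearMap.fst ℝ ℝ ℝ) p := by
    have h1 : HasDerivAt (fun t : ℝ => C i j l / t) (-C i j l / p.1 ^ 2) p.1 := by
      have h2 := (hasDerivAt_const p.1 (C i j l)).fun_div (hasDerivAt_id' p.1) hp
      rwa [zero_mul, zero_sub, mul_one] at h2
    exact h1.comp_hasFDerivAt p hasFDerivAt_fst
  unfold pd
  rw [h.fderiv]
  fin_cases k <;> simp

/-- The terms of the affine Killing equation which are linear in the first derivatives `D i k` of
the components `X k`. -/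
def killingQ (C : Fin 2 → Fin 2 → Fin 2 → ℝ) (D : Fin 2 → Fin 2 → ℝ) (i j l : Fin 2) : ℝ :=
  C 0 j l * D i 0 + C 1 j l * D i 1 + C i 0 l * D j 0 + C i 1 l * D j 1
    - C i j 0 * D 0 l - C i j 1 * D 1 l

/-- The affine Killing equation with denominators cleared. -/
theorem IsAffineKillingAt.cleared {C : Fin 2 → Fin 2 → Fin 2 → ℝ} {X : ℝ × ℝ → Fin 2 → ℝ}
    {p : ℝ × ℝ} (h : IsAffineKillingAt C X p) (hp : p.1 ≠ 0) (i j l : Fin 2) :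
    p.1 * (p.1 * pd i (pd j fun q => X q l) p) = C i j l * X p 0
      - p.1 * killingQ C (fun a b => pd a (fun q => X q b) p) i j l := by
  have h1 := h i j l
  simp only [Fin.sum_univ_two, pd_Gam C i j l _ hp, Gam] at h1
  simp only [killingQ]
  field_simp at h1
  norm_num at h1
  linear_combination h1

theorem pd_killingQ (C : Fin 2 → Fin 2 → Fin 2 → ℝ) {D : Fin 2 → Fin 2 → ℝ × ℝ → ℝ} {p : ℝ × ℝ}
    (hD : ∀ i k, DifferentiableAt ℝ (D i k) p) (m i j l : Fin 2) :
    pd m (fun q => killingQ C (fun a b => D a b q) i j l) p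
      = killingQ C (fun a b => pd m (D a b) p) i j l := by
  have hc (c : ℝ) (a b : Fin 2) : DifferentiableAt ℝ (fun q => c * D a b q) p :=
    (hD a b).const_mul c
  simp only [killingQ]
  rw [pd_sub (by fun_prop) (hc _ _ _), pd_sub (by fun_prop) (hc _ _ _),
    pd_add (by fun_prop) (hc _ _ _), pd_add (by fun_prop) (hc _ _ _),
    pd_add (hc _ _ _) (hc _ _ _)]
  simp only [pd_const_mul (hD _ _)]

/-- The first derivative of the cleared affine Killing equation. -/
theorem pd_cleared {C : Fin 2 → Fin 2 → Fin 2 → ℝ} {X : ℝ × ℝ → Fin 2 → ℝ} {U : Set (ℝ × ℝ)}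
    (hU : IsOpen U) (hU1 : ∀ p ∈ U, 0 < p.1)
    (hX : ∀ p ∈ U, ∀ l, ContDiffAt ℝ (⊤ : ℕ∞) (fun q => X q l) p)
    (hkill : ∀ p ∈ U, IsAffineKillingAt C X p) {p : ℝ × ℝ} (hp : p ∈ U) (m i j l : Fin 2) :
    2 * (if m = 0 then 1 else 0) * (p.1 * pd i (pd j fun q => X q l) p)
        + p.1 ^ 2 * pd m (pd i (pd j fun q => X q l)) p
      = C i j l * pd m (fun q => X q 0) p
        - (if m = 0 then 1 else 0) * killingQ C (fun a b => pd a (fun q => X q b) p) i j l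
        - p.1 * killingQ C (fun a b => pd m (pd a fun q => X q b) p) i j l := by
  have h1 (a b : Fin 2) : DifferentiableAt ℝ (pd a fun q => X q b) p :=
    ((hX p hp b).pd a).differentiableAt (by simp)
  have h2 : DifferentiableAt ℝ (pd i (pd j fun q => X q l)) p :=
    (((hX p hp l).pd j).pd i).differentiableAt (by simp)
  have h0 : DifferentiableAt ℝ (fun q => X q 0) p := (hX p hp 0).differentiableAt (by simp)
  have hQ : DifferentiableAt ℝ
      (fun q => killingQ C (fun a b => pd a (fun q => X q b) q) i j l) p := by
    simp only [killingQ]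
    fun_prop
  have key := pd_congr hU
    (fun q hq => (hkill q hq).cleared (hU1 q hq).ne' i j l) hp m
  rw [pd_fst_mul (by fun_prop), pd_fst_mul h2, pd_sub (h0.const_mul _) (by fun_prop),
    pd_const_mul h0, pd_fst_mul hQ,
    pd_killingQ C (D := fun a b => pd a fun q => X q b) h1] at key
  linear_combination key

/-- Affine Killing vector fields preserve the symmetric Ricci tensor. When the latter is
`lam • 1 / (x¹)²` with `lam ≠ 0`, this says that they are Killing for the hyperbolic metric. -/
theorem hyperbolic_killing {C : Fin 2 → Fin 2 → Fin 2 → ℝ} {lam : ℝ} (hlam : lam ≠ 0)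
    (hrho : rhoS C = lam • (1 : Matrix (Fin 2) (Fin 2) ℝ))
    {X : ℝ × ℝ → Fin 2 → ℝ} {U : Set (ℝ × ℝ)} (hU : IsOpen U) (hU1 : ∀ p ∈ U, 0 < p.1)
    (hX : ∀ p ∈ U, ∀ l, ContDiffAt ℝ (⊤ : ℕ∞) (fun q => X q l) p)
    (hkill : ∀ p ∈ U, IsAffineKillingAt C X p) {p : ℝ × ℝ} (hp : p ∈ U) :
    p.1 * pd 0 (fun q => X q 0) p = X p 0 ∧ p.1 * pd 1 (fun q => X q 1) p = X p 0 ∧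
      pd 0 (fun q => X q 1) p = -pd 1 (fun q => X q 0) p := by
  have hx : p.1 ≠ 0 := (hU1 p hp).ne'
  have R00 := congrFun (congrFun hrho 0) 0
  have R01 := congrFun (congrFun hrho 0) 1
  have R11 := congrFun (congrFun hrho 1) 1
  simp [rhoS, rhoC] at R00 R01 R11
  have S (i j l : Fin 2) : pd i (pd j fun q => X q l) p = (C i j l * X p 0
      - p.1 * killingQ C (fun a b => pd a (fun q => X q b) p) i j l) / p.1 ^ 2 := by
    rw [eq_div_iff (pow_ne_zero 2 hx)]
    linear_combination (hkill p hp).cleared hx i j l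
  have T (j l : Fin 2) := pd_comm ((hX p hp l).pd j) 0 1
  have D (m i j l : Fin 2) := pd_cleared hU hU1 hX hkill hp m i j l
  have e (j l : Fin 2) := And.intro (D 0 1 j l) (D 1 0 j l)
  simp only [T, S] at e
  have t0 := (hkill p hp).cleared hx 0 1 0
  have t1 := (hkill p hp).cleared hx 0 1 1
  rw [pd_comm (hX p hp _), (hkill p hp).cleared hx] at t0 t1
  have e00 := e 0 1
  have e01 := e 1 1
  have e10 := e 0 0
  have e11 := e 1 0
  simp only [killingQ] at t0 t1 e00 e01 e10 e11
  generalize pd 0 (fun q => X q 0) p = a at *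
  generalize pd 1 (fun q => X q 0) p = b at *
  generalize pd 0 (fun q => X q 1) p = c at *
  generalize pd 1 (fun q => X q 1) p = d at *
  generalize X p 0 = u at *
  obtain ⟨f00, g00⟩ := e00
  obtain ⟨f01, g01⟩ := e01
  obtain ⟨f10, g10⟩ := e10
  obtain ⟨f11, g11⟩ := e11
  norm_num at f00 g00 f01 g01 f10 g10 f11 g11
  have h0 : (C 0 1 0 - C 1 0 0) * u
      - p.1 * ((C 0 1 0 - C 1 0 0) * d - (C 0 1 1 - C 1 0 1) * b) = 0 := by
    linear_combination -t0
  have h1 : (C 0 1 1 - C 1 0 1) * u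
      - p.1 * ((C 0 1 1 - C 1 0 1) * a - (C 0 1 0 - C 1 0 0) * c) = 0 := by
    linear_combination -t1
  clear T S D e hkill hX hU hU1 hrho hp
  have L00 := congrArg₂ (· - ·) f00 g00
  have L01 := congrArg₂ (· - ·) f01 g01
  have L10 := congrArg₂ (· - ·) f10 g10
  have L11 := congrArg₂ (· - ·) f11 g11
  field_simp at L00 L01 L10 L11
  clear f00 f01 f10 f11 g00 g01 g10 g11
  have K00 : 2 * lam * (p.1 * a - u) = 0 := by
    linear_combination -L00 + C 0 0 1 * h0 + C 1 0 1 * h1 + (2 * u - 2 * p.1 * a) * R00 - p.1 * c * R01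
  have K11 : 2 * lam * (p.1 * d - u) = 0 := by
    linear_combination L11 - C 0 1 0 * h0 - C 1 1 0 * h1 + (2 * u - 2 * p.1 * d) * R11 - p.1 * b * R01
  have K01 : 2 * lam * p.1 * (c + b) = 0 := by
    linear_combination L10 - L01 + (C 0 1 1 - C 0 0 0) * h0 + (C 1 1 1 - C 1 0 0) * h1
      - 2 * p.1 * c * R11 - 2 * p.1 * b * R00
      - (p.1 * (a + d) - 2 * u) * R01
  refine ⟨?_, ?_, ?_⟩
  · have := (mul_eq_zero.1 K00).resolve_left (by positivity)
    linear_combination this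
  · have := (mul_eq_zero.1 K11).resolve_left (by positivity)
    linear_combination this
  · have := (mul_eq_zero.1 K01).resolve_left (by positivity)
    linear_combination this

/-- If `C ≠ C₊`, a vector field which is both affine Killing and Killing for the hyperbolic metric
has no rotational part. -/
theorem rotation_part_eq_zero {C : Fin 2 → Fin 2 → Fin 2 → ℝ} (hC : C ≠ Cplus)
    {X : ℝ × ℝ → Fin 2 → ℝ} {U : Set (ℝ × ℝ)} (hU : IsOpen U) (hU1 : ∀ p ∈ U, 0 < p.1)
    (hX : ∀ p ∈ U, ∀ l, ContDiffAt ℝ (⊤ : ℕ∞) (fun q => X q l) p)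
    (hkill : ∀ p ∈ U, IsAffineKillingAt C X p)
    (hK : ∀ p ∈ U, p.1 * pd 0 (fun q => X q 0) p = X p 0 ∧
      p.1 * pd 1 (fun q => X q 1) p = X p 0 ∧
      pd 0 (fun q => X q 1) p = -pd 1 (fun q => X q 0) p) {p : ℝ × ℝ} (hp : p ∈ U) :
    pd 1 (fun q => X q 0) p = 0 := by
  by_contra hb
  have hx : p.1 ≠ 0 := (hU1 p hp).ne'
  have hd (a b : Fin 2) : DifferentiableAt ℝ (pd a fun q => X q b) p :=
    ((hX p hp b).pd a).differentiableAt (by simp)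
  have A (m : Fin 2) := pd_congr hU (fun q hq => (hK q hq).1) hp m
  have D (m : Fin 2) := pd_congr hU (fun q hq => (hK q hq).2.1) hp m
  have B (m : Fin 2) := pd_congr hU (fun q hq => (hK q hq).2.2) hp m
  simp only [pd_fst_mul (hd _ _)] at A D
  simp only [pd_neg] at B
  obtain ⟨h1, h2, h3⟩ := hK p hp
  have s00 := pd_comm (hX p hp 0) 0 1
  have s01 := pd_comm (hX p hp 1) 0 1
  have A0 := A 0
  have A1 := A 1
  have D0 := D 0
  have D1 := D 1
  have B0 := B 0
  have B1 := B 1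
  have E (i j l : Fin 2) := (hkill p hp).cleared hx i j l
  have E000 := E 0 0 0
  have E001 := E 0 0 1
  have E010 := E 0 1 0
  have E011 := E 0 1 1
  have E100 := E 1 0 0
  have E101 := E 1 0 1
  have E110 := E 1 1 0
  have E111 := E 1 1 1
  clear E A D B
  have had : pd 0 (fun q => X q 0) p = pd 1 (fun q => X q 1) p :=
    mul_left_cancel₀ hx (h1.trans h2.symm)
  simp only [killingQ, h3, had] at *
  norm_num at A0 A1 D0 D1
  generalize pd 0 (pd 0 fun q => X q 0) p = u00 at *
  generalize pd 0 (pd 1 fun q => X q 0) p = u01 at *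
  generalize pd 1 (pd 0 fun q => X q 0) p = u10 at *
  generalize pd 1 (pd 1 fun q => X q 0) p = u11 at *
  generalize pd 0 (pd 0 fun q => X q 1) p = v00 at *
  generalize pd 0 (pd 1 fun q => X q 1) p = v01 at *
  generalize pd 1 (pd 0 fun q => X q 1) p = v10 at *
  generalize pd 1 (pd 1 fun q => X q 1) p = v11 at *
  generalize pd 1 (fun q => X q 0) p = b at *
  generalize pd 1 (fun q => X q 1) p = d at *
  clear hd hK hkill hX hU hU1 hp h1 h3 had
  have hu00 := A0.resolve_left hx
  have hv01 := D0.resolve_left hx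
  have hu11 : u11 = 0 := by linarith
  have cancel {t : ℝ} (ht : p.1 * b * t = 0) : t = 0 :=
    (mul_eq_zero.1 ht).resolve_left (mul_ne_zero hx hb)
  have F000 : C 1 0 0 + C 0 1 0 + C 0 0 1 = 0 := cancel (by
    linear_combination -E000 + C 0 0 0 * h2 + p.1 ^ 2 * hu00)
  have F010 : C 1 1 0 - C 0 0 0 + C 0 1 1 - 1 = 0 := cancel (by
    linear_combination -E010 + C 0 1 0 * h2 + p.1 ^ 2 * s00 + p.1 * A1)
  have F100 : C 1 1 0 - C 0 0 0 + C 1 0 1 - 1 = 0 := cancel (by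
    linear_combination -E100 + C 1 0 0 * h2 + p.1 * A1)
  have F110 : C 1 1 1 - C 0 1 0 - C 1 0 0 = 0 := cancel (by
    linear_combination -E110 + C 1 1 0 * h2 + p.1 ^ 2 * hu11)
  have F001 : C 1 0 1 + C 0 1 1 - C 0 0 0 + 1 = 0 := cancel (by
    linear_combination -E001 + C 0 0 1 * h2 + p.1 ^ 2 * B0 - p.1 ^ 2 * s00 - p.1 * A1)
  have F011 : C 1 1 1 - C 0 0 1 - C 0 1 0 = 0 := cancel (by
    linear_combination -E011 + C 0 1 1 * h2 + p.1 ^ 2 * hv01)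
  have F101 : C 1 1 1 - C 0 0 1 - C 1 0 0 = 0 := cancel (by
    linear_combination -E101 + C 1 0 1 * h2 + p.1 ^ 2 * (hv01 - s01))
  have F111 : -C 0 1 1 - C 1 0 1 - C 1 1 0 - 1 = 0 := cancel (by
    linear_combination -E111 + C 1 1 1 * h2 + p.1 * D1)
  refine hC ?_
  ext i j k
  fin_cases i <;> fin_cases j <;> fin_cases k <;> simp [Cplus] <;> linarith

/-- If `ρ_{s,C} = λ·Id` with `λ ≠ 0` and `C ≠ C₊` (the Type C exception), then every
smooth vector field on a connected open neighborhood of a point of the half-plane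
`x¹ > 0` satisfying the affine Killing equation for `∇^C` lies in the 2-dimensional
algebra `𝔥`, i.e. has the form `α(x¹∂₁ + x²∂₂) + β∂₂`. -/
theorem killing_fields_definite_case (C : Fin 2 → Fin 2 → Fin 2 → ℝ) (lam : ℝ)
    (hlam : lam ≠ 0) (hrho : rhoS C = lam • (1 : Matrix (Fin 2) (Fin 2) ℝ))
    (hC : C ≠ Cplus) (P : ℝ × ℝ) (hP : 0 < P.1)
    (U : Set (ℝ × ℝ)) (hUo : IsOpen U) (hUc : IsConnected U) (hPU : P ∈ U)
    (hU1 : ∀ p ∈ U, 0 < p.1)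
    (X : ℝ × ℝ → Fin 2 → ℝ) (hX : ∀ l : Fin 2, ContDiffOn ℝ (⊤ : ℕ∞) (fun q => X q l) U)
    (hkill : ∀ p ∈ U, IsAffineKillingAt C X p) :
    ∃ α β : ℝ, ∀ p ∈ U, X p 0 = α * p.1 ∧ X p 1 = α * p.2 + β := by
  have hX' : ∀ p ∈ U, ∀ l, ContDiffAt ℝ (⊤ : ℕ∞) (fun q => X q l) p :=
    fun p hp l => (hX l).contDiffAt (hUo.mem_nhds hp)
  have hK := fun p (hp : p ∈ U) => hyperbolic_killing hlam hrho hUo hU1 hX' hkill hp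
  have hb := fun p (hp : p ∈ U) => rotation_part_eq_zero hC hUo hU1 hX' hkill hK hp
  have hd (p) (hp : p ∈ U) (l) : DifferentiableAt ℝ (fun q => X q l) p :=
    (hX' p hp l).differentiableAt (by simp)
  have hdd (p) (hp : p ∈ U) (i l) : DifferentiableAt ℝ (pd i fun q => X q l) p :=
    ((hX' p hp l).pd i).differentiableAt (by simp)
  obtain ⟨α, hα⟩ : ∃ α, ∀ p ∈ U, pd 0 (fun q => X q 0) p = α := by
    refine ⟨pd 0 (fun q => X q 0) P, fun p hp => ?_⟩
    refine hUo.is_const_of_fderiv_eq_zero hUc.isPreconnected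
      (fun p hp => (hdd p hp 0 0).differentiableWithinAt) (fun p hp => ?_) hp hPU
    refine fderiv_eq_zero_of_pd fun m => ?_
    have h := pd_congr hUo (fun q hq => (hK q hq).1) hp m
    rw [pd_fst_mul (hdd p hp 0 0)] at h
    refine (mul_eq_zero.1 (?_ : p.1 * _ = 0)).resolve_left (hU1 p hp).ne'
    fin_cases m
    · simp at h
      simpa using h
    · simp [hb p hp] at h
      simpa using h
  obtain ⟨β, hβ⟩ : ∃ β, ∀ p ∈ U, X p 1 - α * p.2 = β := by
    refine ⟨X P 1 - α * P.2, fun p hp => ?_⟩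
    have hf (p) (hp : p ∈ U) : HasFDerivAt (fun q => X q 1 - α * q.2)
        (fderiv ℝ (fun q => X q 1) p - α • ContinuousLinearMap.snd ℝ ℝ ℝ) p :=
      (hd p hp 1).hasFDerivAt.sub (hasFDerivAt_snd.const_mul α)
    refine hUo.is_const_of_fderiv_eq_zero (f := fun q => X q 1 - α * q.2) hUc.isPreconnected
      (fun p hp => (hf p hp).differentiableAt.differentiableWithinAt) (fun p hp => ?_) hp hPU
    refine fderiv_eq_zero_of_pd fun m => ?_
    obtain ⟨h1, h2, h3⟩ := hK p hp
    have h4 : pd 1 (fun q => X q 1) p = α := by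
      rw [← hα p hp]
      exact mul_left_cancel₀ (hU1 p hp).ne' (h2.trans h1.symm)
    rw [hb p hp, neg_zero] at h3
    simp only [pd] at h3 h4 ⊢
    rw [(hf p hp).fderiv]
    fin_cases m
    · simpa using h3
    · simpa [sub_eq_zero] using h4
  refine ⟨α, β, fun p hp => ⟨?_, ?_⟩⟩
  · rw [← (hK p hp).1, hα p hp, mul_comm]
  · linear_combination hβ p hp
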